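/- Let α, β, γ be positive real numbers, v := √(αβ) and τ := 1/v. Let χ : ℝ → ℝ be twice differentiable, with derivative χ′ and second derivative χ″. Define w₁(z,t) := (1/2)(χ(t+τz) + χ(t−τz)) + (1/(2βγτ))(χ′(t+τz) − χ′(t−τz)), w₂(z,t) := (βτ/2)(χ(t+τz) − χ(t−τz)) + (1/(2γ))(χ′(t+τz) + χ′(t−τz)), and w₃(t) := χ(t). Then for all z, t ∈ ℝ: ∂_t w₁(z,t) = α·∂_z w₂(z,t), ∂_t w₂(z,t) = β·∂_z w₁(z,t), (d/dt) w₃(t) = γ·w₂(0,t), and w₃(t) = w₁(0,t). (This is the flatness-based parameterization of the solutions of the hyperbolic example system by the flat output χ, equations (flat_param) of the paper, which the paper derives via the method of characteristics.) -/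

import Mathlib

/-- Time derivative of the travelling wave `f (t + c * z)`. -/
theorem hasDerivAt_travelling_wave_time {f f' : ℝ → ℝ} (hf : ∀ x, HasDerivAt f (f' x) x)
    (c z t : ℝ) : HasDerivAt (fun s => f (s + c * z)) (f' (t + c * z)) t :=
  (hf _).comp_add_const t (c * z)

/-- Space derivative of the travelling wave `f (t + c * z)`. -/
theorem hasDerivAt_travelling_wave_space {f f' : ℝ → ℝ} (hf : ∀ x, HasDerivAt f (f' x) x)
    (c z t : ℝ) : HasDerivAt (fun y => f (t + c * y)) (c * f' (t + c * z)) z := by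
  have h : HasDerivAt (fun y => t + c * y) c z := by
    simpa using ((hasDerivAt_id z).const_mul c).const_add t
  simpa [Function.comp_def, mul_comm] using (hf _).comp z h


/-- Flatness-based parameterization of the solutions of the hyperbolic example
system by the flat output `χ` (equations (flat_param) of the paper): with
`v = √(αβ)`, `τ = 1/v` and `χ` twice differentiable, the functions
`w₁(z,t) = ½(χ(t+τz) + χ(t−τz)) + (1/(2βγτ))(χ′(t+τz) − χ′(t−τz))`,
`w₂(z,t) = (βτ/2)(χ(t+τz) − χ(t−τz)) + (1/(2γ))(χ′(t+τz) + χ′(t−τz))`,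
`w₃(t) = χ(t)` satisfy `∂ₜw₁ = α∂_zw₂`, `∂ₜw₂ = β∂_zw₁`, `ẇ₃(t) = γ·w₂(0,t)`
and `w₃(t) = w₁(0,t)`. -/
theorem flat_parameterization (α β γ : ℝ) (hα : 0 < α) (hβ : 0 < β) (hγ : 0 < γ)
    (v τ : ℝ) (hv : v = Real.sqrt (α * β)) (hτ : τ = 1 / v)
    (χ χ' χ'' : ℝ → ℝ)
    (hχ' : ∀ t : ℝ, HasDerivAt χ (χ' t) t)
    (hχ'' : ∀ t : ℝ, HasDerivAt χ' (χ'' t) t)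
    (w₁ w₂ : ℝ → ℝ → ℝ) (w₃ : ℝ → ℝ)
    (hw₁ : ∀ z t : ℝ, w₁ z t = (1 / 2) * (χ (t + τ * z) + χ (t - τ * z))
      + (1 / (2 * β * γ * τ)) * (χ' (t + τ * z) - χ' (t - τ * z)))
    (hw₂ : ∀ z t : ℝ, w₂ z t = (β * τ / 2) * (χ (t + τ * z) - χ (t - τ * z))
      + (1 / (2 * γ)) * (χ' (t + τ * z) + χ' (t - τ * z)))
    (hw₃ : ∀ t : ℝ, w₃ t = χ t) :
    ∀ z t : ℝ,
      (DifferentiableAt ℝ (fun y => w₂ y t) z ∧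
        HasDerivAt (fun s => w₁ z s) (α * deriv (fun y => w₂ y t) z) t) ∧
      (DifferentiableAt ℝ (fun y => w₁ y t) z ∧
        HasDerivAt (fun s => w₂ z s) (β * deriv (fun y => w₁ y t) z) t) ∧
      HasDerivAt w₃ (γ * w₂ 0 t) t ∧
      w₃ t = w₁ 0 t := by
  have hv0 : 0 < v := hv ▸ Real.sqrt_pos.mpr (mul_pos hα hβ)
  have hτ0 : τ ≠ 0 := by rw [hτ]; positivity
  have hαβτ : α * β * τ ^ 2 = 1 := by
    have hv2 : v ^ 2 = α * β := hv ▸ Real.sq_sqrt (mul_pos hα hβ).le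
    rw [← hv2, hτ]
    field_simp
  obtain rfl : w₁ = _ := funext₂ hw₁
  obtain rfl : w₂ = _ := funext₂ hw₂
  obtain rfl : χ = w₃ := (funext hw₃).symm
  intro z t
  simp only [fun s y : ℝ => show s - τ * y = s + -τ * y by ring]
  have hz₁ := (((hasDerivAt_travelling_wave_space hχ' τ z t).fun_add
      (hasDerivAt_travelling_wave_space hχ' (-τ) z t)).const_mul (1 / 2)).fun_add
    (((hasDerivAt_travelling_wave_space hχ'' τ z t).fun_sub
      (hasDerivAt_travelling_wave_space hχ'' (-τ) z t)).const_mul (1 / (2 * β * γ * τ)))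
  have hz₂ := (((hasDerivAt_travelling_wave_space hχ' τ z t).fun_sub
      (hasDerivAt_travelling_wave_space hχ' (-τ) z t)).const_mul (β * τ / 2)).fun_add
    (((hasDerivAt_travelling_wave_space hχ'' τ z t).fun_add
      (hasDerivAt_travelling_wave_space hχ'' (-τ) z t)).const_mul (1 / (2 * γ)))
  have ht₁ := (((hasDerivAt_travelling_wave_time hχ' τ z t).fun_add
      (hasDerivAt_travelling_wave_time hχ' (-τ) z t)).const_mul (1 / 2)).fun_add
    (((hasDerivAt_travelling_wave_time hχ'' τ z t).fun_sub
      (hasDerivAt_travelling_wave_time hχ'' (-τ) z t)).const_mul (1 / (2 * β * γ * τ)))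
  have ht₂ := (((hasDerivAt_travelling_wave_time hχ' τ z t).fun_sub
      (hasDerivAt_travelling_wave_time hχ' (-τ) z t)).const_mul (β * τ / 2)).fun_add
    (((hasDerivAt_travelling_wave_time hχ'' τ z t).fun_add
      (hasDerivAt_travelling_wave_time hχ'' (-τ) z t)).const_mul (1 / (2 * γ)))
  refine ⟨⟨hz₂.differentiableAt, ?_⟩, ⟨hz₁.differentiableAt, ?_⟩, ?_, ?_⟩
  · rw [hz₂.deriv]
    refine ht₁.congr_deriv ?_
    field_simp
    linear_combination (-(β * γ * τ * (χ' (t + τ * z) + χ' (t - τ * z))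
      + χ'' (t + τ * z) - χ'' (t - τ * z))) * hαβτ
  · rw [hz₁.deriv]
    refine ht₂.congr_deriv ?_
    field_simp
    ring
  · refine (hχ' t).congr_deriv ?_
    simp only [mul_zero, add_zero]
    field_simp
    ring
  · simp only [mul_zero, add_zero]
    ring
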